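/- Let n ≥ 1 and let X ⊆ Y be consistent subsets of binom([n], 3) such that the pair (X, Y) is facial. Then the Möbius function of the poset of consistent subsets of binom([n], 3) ordered by inclusion satisfies μ(X, Y) = (−1)^{|Asc(X,Y)|}. -/

import Mathlib

open Finset

/-- `[n] = {1, …, n}`. -/
def box (n : ℕ) : Finset ℕ := Finset.Icc 1 n

/-- `binom([n], k)`, the set of `k`-element subsets of `[n]`. -/
def binom (n k : ℕ) : Finset (Finset ℕ) := Finset.powersetCard k (box n)

/-- `X ⊆ binom([n], d+1)` is closed if for every `(d-1)`-subset `I` of `[n]` and all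
`i < j < k` in `[n] ∖ I`, membership of `I∪{i,j}` and `I∪{j,k}` in `X` forces
`I∪{i,k} ∈ X`. -/
def IsClosedSet (n d : ℕ) (X : Finset (Finset ℕ)) : Prop :=
  ∀ I ∈ binom n (d - 1), ∀ i ∈ box n, ∀ j ∈ box n, ∀ k ∈ box n,
    i ∉ I → j ∉ I → k ∉ I → i < j → j < k →
      I ∪ {i, j} ∈ X → I ∪ {j, k} ∈ X → I ∪ {i, k} ∈ X

/-- `X` is a consistent subset of `binom([n], d+1)`:
both `X` and its complement in `binom([n], d+1)` are closed. -/
def Consistent (n d : ℕ) (X : Finset (Finset ℕ)) : Prop :=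
  X ⊆ binom n (d + 1) ∧ IsClosedSet n d X ∧ IsClosedSet n d (binom n (d + 1) \ X)

open Classical in
/-- The smallest closed subset of `binom([n], d+1)` containing `S`. -/
noncomputable def closureHB (n d : ℕ) (S : Finset (Finset ℕ)) : Finset (Finset ℕ) :=
  (binom n (d + 1)).filter fun I =>
    ∀ T ⊆ binom n (d + 1), S ⊆ T → IsClosedSet n d T → I ∈ T

open Classical in
/-- The ascent set `Asc(X, Y) = {I ∈ Y ∖ X : X ∪ {I} is consistent}`. -/
noncomputable def ascSet (n d : ℕ) (X Y : Finset (Finset ℕ)) : Finset (Finset ℕ) :=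
  (Y \ X).filter fun I => Consistent n d (X ∪ {I})

/-- The pair `(X, Y)` of consistent sets is facial if `Y = X ∪ cl(Asc(X,Y))` and
`X ∪ cl(𝓘)` is consistent for every `𝓘 ⊆ Asc(X,Y)`. -/
def Facial (n : ℕ) (X Y : Finset (Finset ℕ)) : Prop :=
  Consistent n 2 X ∧ Consistent n 2 Y ∧ X ⊆ Y ∧
  Y = X ∪ closureHB n 2 (ascSet n 2 X Y) ∧
  ∀ S ⊆ ascSet n 2 X Y, Consistent n 2 (X ∪ closureHB n 2 S)

/-- The poset of consistent subsets of `binom([n], 3)`, ordered by inclusion. -/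
def ConsPoset (n : ℕ) := {X : Finset (Finset ℕ) // Consistent n 2 X}

noncomputable instance (n : ℕ) : PartialOrder (ConsPoset n) :=
  Subtype.partialOrder _

open Classical in
noncomputable instance (n : ℕ) : LocallyFiniteOrder (ConsPoset n) :=
  Subtype.instLocallyFiniteOrder _

open Classical in
/-- The Möbius function of the poset of consistent subsets of `binom([n],3)`
ordered by inclusion. -/
noncomputable def muHB (n : ℕ) : ConsPoset n → ConsPoset n → ℤ :=
  fun X Y => IncidenceAlgebra.mu ℤ X Y

/-- The truth values of a predicate on the four triples of a `4`-set, listed lexicographically,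
change at most once. -/
def Monotone4 (p q r s : Prop) : Prop :=
  (p → r → q) ∧ (p → s → q) ∧ (p → s → r) ∧ (q → s → r) ∧
  (q → p ∨ r) ∧ (q → p ∨ s) ∧ (r → p ∨ s) ∧ (r → q ∨ s)

/-- Consistency of a predicate on increasing triples of natural numbers. -/
def TripleConsistent (f : ℕ → ℕ → ℕ → Prop) : Prop :=
  ∀ a b c d, a < b → b < c → c < d → Monotone4 (f a b c) (f a b d) (f a c d) (f b c d)

/-- Switching the value of `f` at `x < y < z` to true keeps every `4`-set through it monotone. -/
def Flippable (f : ℕ → ℕ → ℕ → Prop) (x y z : ℕ) : Prop :=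
  (∀ w, w < x → Monotone4 (f w x y) (f w x z) (f w y z) True) ∧
  (∀ w, x < w → w < y → Monotone4 (f x w y) (f x w z) True (f w y z)) ∧
  (∀ w, y < w → w < z → Monotone4 (f x y w) True (f x w z) (f y w z)) ∧
  (∀ w, z < w → Monotone4 True (f x y w) (f x z w) (f y z w))

/-- In the pseudoline arrangement with inversion set `f`, line `w` crosses `x` before `y`. -/
def Precedes (f : ℕ → ℕ → ℕ → Prop) (w x y : ℕ) : Prop :=
  (w < x ∧ x < y ∧ ¬ f w x y) ∨ (x < w ∧ w < y ∧ ¬ f x w y) ∨ (x < y ∧ y < w ∧ ¬ f x y w) ∨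
  (w < y ∧ y < x ∧ f w y x) ∨ (y < w ∧ w < x ∧ f y w x) ∨ (y < x ∧ x < w ∧ f y x w)

section Arrangement

variable {f h : ℕ → ℕ → ℕ → Prop}

theorem Precedes.ne {w x y : ℕ} (hp : Precedes f w x y) : w ≠ x ∧ w ≠ y ∧ x ≠ y := by
  unfold Precedes at hp; omega

theorem Precedes.asymm {w x y : ℕ} (hp : Precedes f w x y) : ¬ Precedes f w y x := by
  unfold Precedes at *; grind

theorem precedes_or {w x y : ℕ} (hwx : w ≠ x) (hwy : w ≠ y) (hxy : x ≠ y) :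
    Precedes f w x y ∨ Precedes f w y x := by
  rcases lt_or_gt_of_ne hwx with h1 | h1 <;> rcases lt_or_gt_of_ne hwy with h2 | h2 <;>
    rcases lt_or_gt_of_ne hxy with h3 | h3 <;> unfold Precedes <;> grind

theorem TripleConsistent.precedes_trans (hf : TripleConsistent f) {w x y z : ℕ}
    (h1 : Precedes f w x y) (h2 : Precedes f w y z) : Precedes f w x z := by
  have hxz : x ≠ z := by
    rintro rfl
    exact h1.asymm h2
  unfold TripleConsistent Monotone4 at hf
  unfold Precedes at *
  grind

/-- Lines `a` and `d` cross line `j` consecutively, `j` lies between them and the triple `a j d`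
is not inverted. -/
structure IsEdge (f : ℕ → ℕ → ℕ → Prop) (a j d : ℕ) : Prop where
  left_lt : a < j
  lt_right : j < d
  not_mem : ¬ f a j d
  adjacent : ∀ v, ¬ (Precedes f j a v ∧ Precedes f j v d)

/-- Line `v` cuts the triangle `a j d` through its sides on `a` and `d`. -/
def Cuts (f : ℕ → ℕ → ℕ → Prop) (a j d v : ℕ) : Prop :=
  a < v ∧ v < d ∧ Precedes f a j v ∧ Precedes f a v d

theorem IsEdge.flippable (hf : TripleConsistent f) {a j d : ℕ} (he : IsEdge f a j d)
    (hcut : ∀ v, ¬ Cuts f a j d v) : Flippable f a j d := by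
  obtain ⟨haj, hjd, h0, hadj⟩ := he
  refine ⟨fun v h1 => ?_, fun v h1 h2 => ?_, fun v h1 h2 => ?_, fun v h1 => ?_⟩
  · have e1 := hf v a j d h1 haj hjd
    have e2 := hadj v
    unfold Precedes at e2; unfold Monotone4 at *
    grind
  · have e1 := hf a v j d h1 h2 hjd
    have e2 := hadj v
    have e3 := hcut v
    unfold Cuts at e3; unfold Precedes at *; unfold Monotone4 at *
    grind
  · have e1 := hf a j v d haj h1 h2
    have e2 := hadj v
    have e3 := hcut v
    unfold Cuts at e3; unfold Precedes at *; unfold Monotone4 at *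
    grind
  · have e1 := hf a j d v haj hjd h1
    have e2 := hadj v
    unfold Precedes at e2; unfold Monotone4 at *
    grind

theorem TripleConsistent.five (hf : TripleConsistent f) {a b c d e : ℕ} (hab : a < b)
    (hbc : b < c) (hcd : c < d) (hde : d < e) :
    Monotone4 (f a b c) (f a b d) (f a c d) (f b c d) ∧
    Monotone4 (f a b c) (f a b e) (f a c e) (f b c e) ∧
    Monotone4 (f a b d) (f a b e) (f a d e) (f b d e) ∧
    Monotone4 (f a c d) (f a c e) (f a d e) (f c d e) ∧
    Monotone4 (f b c d) (f b c e) (f b d e) (f c d e) := by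
  refine ⟨hf _ _ _ _ ?_ ?_ ?_, hf _ _ _ _ ?_ ?_ ?_, hf _ _ _ _ ?_ ?_ ?_, hf _ _ _ _ ?_ ?_ ?_,
    hf _ _ _ _ ?_ ?_ ?_⟩ <;> omega

theorem IsEdge.cuts_of_between (hf : TripleConsistent f) {a j d p v : ℕ} (he : IsEdge f a j d)
    (hp : Cuts f a j d p) (h1 : Precedes f p a v) (h2 : Precedes f p v d) : Cuts f a j d v := by
  obtain ⟨haj, hjd, h0, hadj⟩ := he
  have hadj := hadj v
  obtain ⟨hap, hpd, hp1, hp2⟩ := hp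
  have hpj := hp1.ne
  have hva := h1.ne
  have hvd := h2.ne
  have hvj : v ≠ j := by
    rintro rfl
    unfold Precedes at *
    grind
  rcases lt_or_gt_of_ne hpj.2.2 with hlt | hlt
  · rcases lt_or_gt_of_ne hva.2.2 with g | g
    · rcases lt_or_gt_of_ne hvj with g' | g'
      · have := hf.five g g' hlt hpd
        unfold Cuts Precedes Monotone4 at *
        grind
      · rcases lt_or_gt_of_ne hva.2.1 with g2 | g2
        · rcases lt_or_gt_of_ne hvd.2.2 with g3 | g3
          · have := hf.five haj hlt g2 g3
            unfold Cuts Precedes Monotone4 at *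
            grind
          · have := hf.five haj hlt hpd g3
            unfold Cuts Precedes Monotone4 at *
            grind
        · have := hf.five haj g' g2 hpd
          unfold Cuts Precedes Monotone4 at *
          grind
    · have := hf.five g haj hlt hpd
      unfold Cuts Precedes Monotone4 at *
      grind
  · rcases lt_or_gt_of_ne hva.2.2 with g | g
    · rcases lt_or_gt_of_ne hvj with g' | g'
      · rcases lt_or_gt_of_ne hva.2.1 with g2 | g2
        · have := hf.five hap g2 g' hjd
          unfold Cuts Precedes Monotone4 at *
          grind
        · have := hf.five g g2 hlt hjd
          unfold Cuts Precedes Monotone4 at *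
          grind
      · rcases lt_or_gt_of_ne hvd.2.2 with g3 | g3
        · have := hf.five hap hlt g' g3
          unfold Cuts Precedes Monotone4 at *
          grind
        · have := hf.five hap hlt hjd g3
          unfold Cuts Precedes Monotone4 at *
          grind
    · have := hf.five g hap hlt hjd
      unfold Cuts Precedes Monotone4 at *
      grind

end Arrangement

section Descent

variable {f h : ℕ → ℕ → ℕ → Prop}

theorem TripleConsistent.isStrictOrder_precedes (hf : TripleConsistent f) (w : ℕ) :
    IsStrictOrder ℕ (Precedes f w) where
  irrefl _ hx := hx.ne.2.2 rfl
  trans _ _ _ := hf.precedes_trans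

theorem Set.Finite.exists_forall_not_rel {α : Type*} {s : Set α} (hs : s.Finite)
    (hne : s.Nonempty) (r : α → α → Prop) [IsStrictOrder α r] : ∃ m ∈ s, ∀ v ∈ s, ¬ r v m := by
  obtain ⟨m, hm, hmin⟩ :=
    (Set.wellFoundedOn_iff.1 (hs.wellFoundedOn (r := r))).has_min s hne
  exact ⟨m, hm, fun v hv hr => hmin v hv ⟨hr, hv, hm⟩⟩

theorem TripleConsistent.exists_first (hf : TripleConsistent f) (w : ℕ) {s : Set ℕ}
    (hs : s.Finite) (hne : s.Nonempty) : ∃ m ∈ s, ∀ v ∈ s, ¬ Precedes f w v m :=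
  have := hf.isStrictOrder_precedes w
  hs.exists_forall_not_rel hne _

theorem TripleConsistent.exists_last (hf : TripleConsistent f) (w : ℕ) {s : Set ℕ}
    (hs : s.Finite) (hne : s.Nonempty) : ∃ m ∈ s, ∀ v ∈ s, ¬ Precedes f w m v :=
  have := hf.isStrictOrder_precedes w
  hs.exists_forall_not_rel hne (Function.swap (Precedes f w))

/-- The triple `p < w < q` on which `h` and `f` disagree can be chosen to have minimal span. Then
any two lines crossing `w` on the segment from `p` to `q` cross each other in `h` before `w`. -/
theorem triple_of_minimal_span (hh : TripleConsistent h)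
    (hfh : ∀ a b c, f a b c → h a b c) {p w q u v : ℕ} (hpw : p < w) (hwq : w < q)
    (h1 : h p w q) (h0 : ¬ f p w q)
    (hmin : ∀ a b c, a < b → b < c → h a b c → ¬ f a b c → q - p ≤ c - a)
    (huw : u < w) (hwv : w < v) (hu : u = p ∨ Precedes f w p u)
    (hv : v = q ∨ Precedes f w v q) : h u w v := by
  have e1 : h p w v := by
    by_contra hc
    rcases lt_trichotomy v q with hlt | rfl | hlt
    · have := hmin w v q hwv hlt
      have := hh p w v q hpw hwv hlt
      unfold Precedes at hv; unfold Monotone4 at *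
      grind
    · exact hc h1
    · have := hh p w q v hpw hwq hlt
      have := hfh w q v
      unfold Precedes at hv; unfold Monotone4 at *
      grind
  rcases lt_trichotomy u p with hlt | rfl | hlt
  · have := hh u p w v hlt hpw hwv
    have := hfh u p w
    unfold Precedes at hu; unfold Monotone4 at *
    grind
  · exact e1
  · have := hmin p u w hlt huw
    have := hh p u w v hlt huw hwv
    unfold Precedes at hu; unfold Monotone4 at *
    grind

theorem exists_edge (hf : TripleConsistent f) (hh : TripleConsistent h)
    (hfh : ∀ a b c, f a b c → h a b c) {n : ℕ} (hn : ∀ a b c, f a b c → c ≤ n)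
    (hne : ∃ a b c, a < b ∧ b < c ∧ h a b c ∧ ¬ f a b c) :
    ∃ a j d, IsEdge f a j d ∧ h a j d := by
  classical
  have hne' : ∃ k a b c, a < b ∧ b < c ∧ h a b c ∧ ¬ f a b c ∧ c - a = k := by
    obtain ⟨a, b, c, h1⟩ := hne
    exact ⟨c - a, a, b, c, by tauto⟩
  obtain ⟨p, w, q, hpw, hwq, h1, h0, hk⟩ := Nat.find_spec hne'
  have hmin : ∀ a b c, a < b → b < c → h a b c → ¬ f a b c → q - p ≤ c - a := by
    intro a b c h1 h2 h3 h4
    rw [hk]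
    exact Nat.find_min' hne' ⟨a, b, c, h1, h2, h3, h4, rfl⟩
  have hpq : Precedes f w p q := by unfold Precedes; grind
  obtain ⟨v, ⟨hwv, hv, hpv⟩, hvmin⟩ := hf.exists_first w
    (s := {v | w < v ∧ (v = q ∨ Precedes f w v q) ∧ Precedes f w p v})
    ((Set.finite_Iic (n + q)).subset (by
      rintro v ⟨g1, g2, -⟩
      have := hn w q v
      unfold Precedes at g2
      grind)) ⟨q, hwq, Or.inl rfl, hpq⟩
  obtain ⟨u, ⟨hu, huv⟩, humax⟩ := hf.exists_last w
    (s := {u | (u = p ∨ Precedes f w p u) ∧ Precedes f w u v})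
    ((Set.finite_Iic (n + v + w)).subset (by
      rintro u ⟨-, g2⟩
      have := hn w v u
      have := hn v w u
      unfold Precedes at g2
      grind)) ⟨p, Or.inl rfl, hpv⟩
  have huq : Precedes f w u q := by
    rcases hv with rfl | hv
    · exact huv
    · exact hf.precedes_trans huv hv
  have huw : u < w := by
    rcases hu with rfl | hu
    · exact hpw
    · by_contra hc
      exact hvmin u ⟨lt_of_le_of_ne (not_lt.1 hc) hu.ne.2.1, Or.inr huq, hu⟩ huv
  refine ⟨u, w, v, ⟨huw, hwv, ?_, fun x hx => humax x ⟨Or.inr ?_, hx.2⟩ hx.1⟩,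
    triple_of_minimal_span hh hfh hpw hwq h1 h0 hmin huw hwv hu hv⟩
  · unfold Precedes at huv
    grind
  · rcases hu with rfl | hu
    · exact hx.1
    · exact hf.precedes_trans hu hx.1

/-- The invariant maintained while walking along the cutters of the triangle `a j d`: `w` is the
next cutter after `p`, and every other cutter is on the expected side. -/
structure WalkInvariant (f h : ℕ → ℕ → ℕ → Prop) (a j d p w : ℕ) : Prop where
  start : p = a ∨ Cuts f a j d p ∧ ¬ f a p w ∧ ¬ f p w d ∧ ¬ h a p w
  cuts : Cuts f a j d w
  lt : p < w
  below : ∀ v, Cuts f a j d v → v < w → v = p ∨ Precedes f w v p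
  above : ∀ v, Cuts f a j d v → w < v → Precedes f w p v

theorem Cuts.not_mem {a j d v : ℕ} (hv : Cuts f a j d v) :
    ¬ f a v d := by
  unfold Cuts Precedes at hv
  grind

theorem Cuts.mem (hf : TripleConsistent f) (hh : TripleConsistent h)
    (hfh : ∀ a b c, f a b c → h a b c) {a j d v : ℕ} (he : IsEdge f a j d) (h1 : h a j d)
    (hv : Cuts f a j d v) : h a v d := by
  obtain ⟨haj, hjd, h0, hadj⟩ := he
  obtain ⟨hav, hvd, g1, g2⟩ := hv
  have hadj := hadj v
  rcases lt_or_gt_of_ne g1.ne.2.2 with hlt | hlt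
  · have := hf a j v d haj hlt hvd
    have := hh a j v d haj hlt hvd
    have := hfh j v d
    unfold Precedes at *; unfold Monotone4 at *
    grind
  · have := hf a v j d hav hlt hjd
    have := hh a v j d hav hlt hjd
    have := hfh a v j
    unfold Precedes at *; unfold Monotone4 at *
    grind

theorem WalkInvariant.exists_edge (hf : TripleConsistent f) (hh : TripleConsistent h)
    (hfh : ∀ a b c, f a b c → h a b c) {a j d p w : ℕ} (he : IsEdge f a j d) (h1 : h a j d)
    (hw : WalkInvariant f h a j d p w) :
    ∃ p w q, IsEdge f p w q ∧ h p w q ∧ Cuts f a j d w ∧ ∀ v, Cuts f p w q v → Cuts f a j d v := by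
  induction hk : d - w using Nat.strong_induction_on generalizing p w with
  | _ k ih =>
    obtain ⟨hstart, hcw, hpw, hbelow, habove⟩ := hw
    obtain ⟨haw, hwd, gj, gd⟩ := hcw
    have hcw : Cuts f a j d w := ⟨haw, hwd, gj, gd⟩
    have hawd : h a w d := hcw.mem hf hh hfh he h1
    have nawd : ¬ f a w d := hcw.not_mem
    have hap : p = a ∨ Precedes f w a p := by
      unfold Precedes; unfold Cuts at hstart; grind
    have hpd : Precedes f w p d := by
      unfold Precedes; unfold Cuts at hstart; grind
    have hcut : ∀ v, Precedes f w p v → Precedes f w v d → Cuts f a j d v := by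
      intro v g1 g2
      refine he.cuts_of_between hf hcw ?_ g2
      rcases hap with rfl | hap
      · exact g1
      · exact hf.precedes_trans hap g1
    obtain ⟨q, ⟨hpq, hqd⟩, hqmin⟩ := hf.exists_first w
      (s := {v | Precedes f w p v ∧ (v = d ∨ Precedes f w v d)})
      ((Set.finite_Iic d).subset (by
        rintro v ⟨g1, rfl | g2⟩
        · exact le_refl v
        · exact (hcut v g1 g2).2.1.le)) ⟨d, hpd, Or.inl rfl⟩
    have hadj : ∀ v, ¬ (Precedes f w p v ∧ Precedes f w v q) := by
      rintro v ⟨g1, g2⟩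
      refine hqmin v ⟨g1, Or.inr ?_⟩ g2
      rcases hqd with rfl | hqd
      · exact g2
      · exact hf.precedes_trans g2 hqd
    have hcq : q = d ∨ Cuts f a j d q := hqd.imp id (hcut q hpq)
    have hwq : w < q := by
      rcases hcq with rfl | hcq
      · exact hwd
      · by_contra hc
        rcases hbelow q hcq (lt_of_le_of_ne (not_lt.1 hc) hpq.ne.2.1.symm) with rfl | g
        · exact hpq.ne.2.2 rfl
        · exact g.asymm hpq
    have n0 : ¬ f p w q := by unfold Precedes at hpq; grind
    by_cases hpwq : h p w q
    · refine ⟨p, w, q, ⟨hpw, hwq, n0, hadj⟩, hpwq, hcw, fun v hv => ?_⟩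
      obtain ⟨hpv, hvq, c1, c2⟩ := hv
      have hqd' : q ≤ d := by
        rcases hcq with rfl | hcq
        · exact le_refl _
        · exact hcq.2.1.le
      rcases hstart with rfl | ⟨hcp, b1, b2, b3⟩
      · refine ⟨hpv, by omega, hf.precedes_trans gj c1, ?_⟩
        rcases hcq with rfl | hcq
        · exact c2
        · exact hf.precedes_trans c2 hcq.2.2.2
      · have hap' := hcp.1
        refine he.cuts_of_between hf hcp ?_ ?_
        · refine hf.precedes_trans ?_ c1
          unfold Precedes; grind
        · rcases hqd with rfl | hqd
          · exact c2
          · refine hf.precedes_trans c2 ?_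
            have hqd2 := hcq.resolve_left hqd.ne.2.2
            have := hf p w q d hpw hwq hqd2.2.1
            have := hqd2.2.1
            unfold Precedes at *; unfold Monotone4 at *
            grind
    · have hqne : q ≠ d := by
        rintro rfl
        rcases hstart with rfl | ⟨hcp, b1, b2, b3⟩
        · exact hpwq hawd
        · have := hh a p w q hcp.1 hpw hwq
          have := hcp.mem hf hh hfh he h1
          unfold Monotone4 at *
          grind
      have hcq := hcq.resolve_left hqne
      have hqd := hqd.resolve_left hqne
      have hqd' := hcq.2.1
      refine ih (d - q) (by omega) (p := w) (w := q) ⟨Or.inr ⟨hcw, ?_, ?_, ?_⟩, hcq, hwq, ?_, ?_⟩ rfl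
      · have haq : Precedes f w a q := by
          rcases hap with rfl | hap
          · exact hpq
          · exact hf.precedes_trans hap hpq
        unfold Precedes at haq
        grind
      · unfold Precedes at hqd
        grind
      · rcases hstart with rfl | ⟨hcp, b1, b2, b3⟩
        · exact hpwq
        · have := hh a p w q hcp.1 hpw hwq
          unfold Monotone4 at *
          grind
      · intro v hv hvq
        rcases lt_trichotomy v w with hlt | rfl | hlt
        · right
          have hvq' : Precedes f w v q := by
            rcases hbelow v hv hlt with rfl | g
            · exact hpq
            · exact hf.precedes_trans g hpq
          unfold Precedes at *
          grind
        · exact Or.inl rfl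
        · right
          have g1 := habove v hv hlt
          have g2 := hadj v
          have g3 := precedes_or (f := f) (w := w) (x := v) (y := q) hlt.ne hwq.ne hvq.ne
          unfold Precedes at *
          grind
      · intro v hv hqv
        have hlt := hwq.trans hqv
        have g1 := habove v hv hlt
        have g2 := hadj v
        have g3 := precedes_or (f := f) (w := w) (x := v) (y := q) hlt.ne hwq.ne hqv.ne'
        unfold Precedes at *
        grind

theorem TripleConsistent.exists_walkInvariant (hf : TripleConsistent f) {a j d : ℕ}
    (hc : ∃ v, Cuts f a j d v) : ∃ w, WalkInvariant f h a j d a w := by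
  obtain ⟨w, hw, hmin⟩ := hf.exists_first a (s := {v | Cuts f a j d v})
    ((Set.finite_Iic d).subset fun v hv => hv.2.1.le) hc
  refine ⟨w, Or.inl rfl, hw, hw.1, fun v hv hlt => Or.inr ?_, fun v hv hlt => ?_⟩
  all_goals
    have g1 := hmin v hv
    have g2 := hv.1
    have g3 := hw.1
    unfold Precedes at *
    grind

theorem exists_flippable (hf : TripleConsistent f) (hh : TripleConsistent h)
    (hfh : ∀ a b c, f a b c → h a b c) {n : ℕ} (hn : ∀ a b c, f a b c → c ≤ n)
    (hne : ∃ a b c, a < b ∧ b < c ∧ h a b c ∧ ¬ f a b c) :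
    ∃ x y z, x < y ∧ y < z ∧ h x y z ∧ ¬ f x y z ∧ Flippable f x y z := by
  obtain ⟨a, j, d, he, h1⟩ := exists_edge hf hh hfh hn hne
  have hfin : ∀ a j d, {v | Cuts f a j d v}.Finite := fun a j d =>
    (Set.finite_Iic d).subset fun v hv => hv.2.1.le
  induction hk : {v | Cuts f a j d v}.ncard using Nat.strong_induction_on generalizing a j d with
  | _ k ih =>
    by_cases hc : ∃ v, Cuts f a j d v
    · obtain ⟨w₀, hw₀⟩ := hf.exists_walkInvariant (h := h) hc
      obtain ⟨p, w, q, he', h1', hw, hsub⟩ := hw₀.exists_edge hf hh hfh he h1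
      refine ih _ ?_ p w q he' h1' rfl
      rw [← hk]
      exact Set.ncard_lt_ncard ⟨hsub, fun hs => (hs hw).2.2.1.ne.2.2 rfl⟩ (hfin a j d)
    · exact ⟨a, j, d, he.left_lt, he.lt_right, h1, he.not_mem,
        he.flippable hf fun v hv => hc ⟨v, hv⟩⟩

end Descent

section Bridge

variable {n : ℕ} {X Z : Finset (Finset ℕ)}

theorem mem_binom_three {a b c : ℕ} (hab : a < b) (hbc : b < c) :
    ({a, b, c} : Finset ℕ) ∈ binom n 3 ↔ 1 ≤ a ∧ c ≤ n := by
  have hcard : ({a, b, c} : Finset ℕ).card = 3 :=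
    Finset.card_eq_three.2 ⟨a, b, c, hab.ne, (hab.trans hbc).ne, hbc.ne, rfl⟩
  simp only [binom, Finset.mem_powersetCard, hcard, and_true, _root_.box, Finset.insert_subset_iff,
    Finset.singleton_subset_iff, Finset.mem_Icc]
  omega

theorem exists_triple_of_mem_binom {I : Finset ℕ} (hI : I ∈ binom n 3) :
    ∃ a b c, a < b ∧ b < c ∧ I = {a, b, c} := by
  obtain ⟨a, b, c, hab, hac, hbc, rfl⟩ :=
    Finset.card_eq_three.1 (Finset.mem_powersetCard.1 hI).2
  have key : ∀ x y z : ℕ, x ≠ y → x ≠ z → y ≠ z → x < y →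
      ∃ a b c, a < b ∧ b < c ∧ ({x, y, z} : Finset ℕ) = {a, b, c} := by
    intro x y z hxy hxz hyz hlt
    rcases lt_or_gt_of_ne hyz with h1 | h1
    · exact ⟨x, y, z, hlt, h1, rfl⟩
    · rcases lt_or_gt_of_ne hxz with h2 | h2
      · exact ⟨x, z, y, h2, h1, by ext; simp; tauto⟩
      · exact ⟨z, x, y, h2, hlt, by ext; simp; tauto⟩
  rcases lt_or_gt_of_ne hab with h1 | h1
  · exact key a b c hab hac hbc h1
  · rw [Finset.insert_comm]
    exact key b a c hab.symm hbc hac h1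

theorem triple_eq_triple_iff {a b c x y z : ℕ} (hab : a < b) (hbc : b < c) (hxy : x < y)
    (hyz : y < z) : ({a, b, c} : Finset ℕ) = {x, y, z} ↔ a = x ∧ b = y ∧ c = z := by
  constructor
  · intro h
    have h' : ∀ t, t = a ∨ t = b ∨ t = c ↔ t = x ∨ t = y ∨ t = z := by
      intro t
      simpa using Finset.ext_iff.1 h t
    have := h' a
    have := h' b
    have := h' c
    have := h' x
    have := h' y
    have := h' z
    omega
  · rintro ⟨rfl, rfl, rfl⟩
    rfl

/-- The indicator predicate of a family of triples. -/
def TripleMem (X : Finset (Finset ℕ)) (a b c : ℕ) : Prop := {a, b, c} ∈ X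

theorem union_pair_mem_binom {I : Finset ℕ} {i j : ℕ} (hI : I ∈ binom n 1) (hi : i ∈ _root_.box n)
    (hj : j ∈ _root_.box n) (hiI : i ∉ I) (hjI : j ∉ I) (hij : i < j) :
    I ∪ {i, j} ∈ binom n 3 := by
  obtain ⟨h1, h2⟩ := Finset.mem_powersetCard.1 hI
  refine Finset.mem_powersetCard.2 ⟨?_, ?_⟩
  · simp [Finset.insert_subset_iff, h1, hi, hj]
  · rw [Finset.card_union_of_disjoint (by simp [hiI, hjI]), h2, Finset.card_pair hij.ne]

/-- Consistency unfolds to the closure conditions at each `1`-set and three further elements. -/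
theorem consistent_iff_singleton (hX : X ⊆ binom n 3) :
    Consistent n 2 X ↔ ∀ p i j k, p ∈ _root_.box n → i ∈ _root_.box n → k ∈ _root_.box n →
      p ≠ i → p ≠ j → p ≠ k → i < j → j < k →
      (TripleMem X p i j → TripleMem X p j k → TripleMem X p i k) ∧
      (TripleMem X p i k → TripleMem X p i j ∨ TripleMem X p j k) := by
  constructor
  · rintro ⟨-, h1, h2⟩ p i j k hp hi hk hpi hpj hpk hij hjk
    have hI : {p} ∈ binom n 1 := Finset.mem_powersetCard.2 ⟨by simpa using hp, by simp⟩
    have hj : j ∈ _root_.box n := by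
      simp only [_root_.box, Finset.mem_Icc] at *
      omega
    have hpi' : i ∉ ({p} : Finset ℕ) := by simpa using hpi.symm
    have hpj' : j ∉ ({p} : Finset ℕ) := by simpa using hpj.symm
    have hpk' : k ∉ ({p} : Finset ℕ) := by simpa using hpk.symm
    refine ⟨h1 {p} hI i hi j hj k hk hpi' hpj' hpk' hij hjk, fun h => ?_⟩
    by_contra! hc
    exact (Finset.mem_sdiff.1 (h2 {p} hI i hi j hj k hk hpi' hpj' hpk' hij hjk
      (Finset.mem_sdiff.2 ⟨union_pair_mem_binom hI hi hj hpi' hpj' hij, hc.1⟩)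
      (Finset.mem_sdiff.2 ⟨union_pair_mem_binom hI hj hk hpj' hpk' hjk, hc.2⟩))).2 h
  · intro hm
    have key : ∀ I ∈ binom n 1, ∀ i ∈ _root_.box n, ∀ j ∈ _root_.box n, ∀ k ∈ _root_.box n,
        i ∉ I → j ∉ I → k ∉ I → i < j → j < k →
        (I ∪ {i, j} ∈ X → I ∪ {j, k} ∈ X → I ∪ {i, k} ∈ X) ∧
        (I ∪ {i, k} ∈ X → I ∪ {i, j} ∈ X ∨ I ∪ {j, k} ∈ X) := by
      intro I hI i hi j hj k hk hiI hjI hkI hij hjk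
      obtain ⟨p, rfl⟩ := Finset.card_eq_one.1 (Finset.mem_powersetCard.1 hI).2
      rw [Finset.mem_singleton, eq_comm] at hiI hjI hkI
      exact hm p i j k (by simpa using (Finset.mem_powersetCard.1 hI).1) hi hk hiI hjI hkI hij hjk
    refine ⟨hX, fun I hI i hi j hj k hk hiI hjI hkI hij hjk =>
      (key I hI i hi j hj k hk hiI hjI hkI hij hjk).1, ?_⟩
    intro I hI i hi j hj k hk hiI hjI hkI hij hjk h1 h2
    rw [Finset.mem_sdiff] at *
    refine ⟨union_pair_mem_binom hI hi hk hiI hkI (hij.trans hjk), fun h => ?_⟩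
    exact ((key I hI i hi j hj k hk hiI hjI hkI hij hjk).2 h).elim h1.2 h2.2

theorem tripleMem_rotate {p i j : ℕ} : TripleMem X p i j ↔ TripleMem X i j p := by
  have : ({p, i, j} : Finset ℕ) = {i, j, p} := by
    ext
    simp
    tauto
  rw [TripleMem, TripleMem, this]

theorem tripleMem_swap {p i j : ℕ} : TripleMem X p i j ↔ TripleMem X i p j := by
  rw [TripleMem, TripleMem, Finset.insert_comm]

/-- Consistency unfolds to monotonicity at each `4`-subset of `[n]`. -/
theorem consistent_iff (hX : X ⊆ binom n 3) :
    Consistent n 2 X ↔ ∀ a b c d, 1 ≤ a → a < b → b < c → c < d → d ≤ n →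
      Monotone4 (TripleMem X a b c) (TripleMem X a b d) (TripleMem X a c d)
        (TripleMem X b c d) := by
  rw [consistent_iff_singleton hX]
  simp only [_root_.box, Finset.mem_Icc]
  constructor
  · intro key a b c d ha hab hbc hcd hd
    have ka := key a b c d (by omega) (by omega) (by omega) (by omega) (by omega) (by omega)
      (by omega) (by omega)
    have kb := key b a c d (by omega) (by omega) (by omega) (by omega) (by omega) (by omega)
      (by omega) (by omega)
    have kc := key c a b d (by omega) (by omega) (by omega) (by omega) (by omega) (by omega)
      (by omega) (by omega)
    have kd := key d a b c (by omega) (by omega) (by omega) (by omega) (by omega) (by omega)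
      (by omega) (by omega)
    rw [tripleMem_swap (p := b), tripleMem_swap (p := b) (i := a) (j := d)] at kb
    rw [tripleMem_rotate (p := c), tripleMem_swap (p := c), tripleMem_swap (p := c)] at kc
    rw [tripleMem_rotate (p := d), tripleMem_rotate (p := d) (i := b),
      tripleMem_rotate (p := d) (j := c)] at kd
    exact ⟨ka.1, kb.1, kc.1, kd.1, ka.2, kb.2, kc.2, kd.2⟩
  · intro hm p i j k hp hi hk hpi hpj hpk hij hjk
    rcases lt_or_gt_of_ne hpi with g1 | g1
    · obtain ⟨m1, -, -, -, m2, -⟩ := hm p i j k (by omega) g1 hij hjk (by omega)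
      exact ⟨m1, m2⟩
    · rcases lt_or_gt_of_ne hpj with g2 | g2
      · obtain ⟨-, m1, -, -, -, m2, -⟩ := hm i p j k (by omega) g1 g2 hjk (by omega)
        rw [tripleMem_swap (p := p), tripleMem_swap (p := p) (i := i) (j := k)]
        exact ⟨m1, m2⟩
      · rcases lt_or_gt_of_ne hpk with g3 | g3
        · obtain ⟨-, -, m1, -, -, -, m2, -⟩ := hm i j p k (by omega) hij g2 g3 (by omega)
          rw [tripleMem_rotate (p := p), tripleMem_swap (p := p), tripleMem_swap (p := p)]
          exact ⟨m1, m2⟩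
        · obtain ⟨-, -, -, m1, -, -, -, m2⟩ := hm i j k p (by omega) hij hjk g3 (by omega)
          rw [tripleMem_rotate (p := p), tripleMem_rotate (p := p) (i := j),
            tripleMem_rotate (p := p) (j := k)]
          exact ⟨m1, m2⟩

theorem TripleMem.bounds (hX : X ⊆ binom n 3) {a b c : ℕ} (hab : a < b) (hbc : b < c)
    (h : TripleMem X a b c) : 1 ≤ a ∧ c ≤ n :=
  (mem_binom_three hab hbc).1 (hX h)

theorem TripleMem.le (hX : X ⊆ binom n 3) {a b c : ℕ} (h : TripleMem X a b c) : c ≤ n := by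
  have := (Finset.mem_powersetCard.1 (hX h)).1 (show c ∈ ({a, b, c} : Finset ℕ) by simp)
  exact (Finset.mem_Icc.1 this).2

theorem Consistent.tripleConsistent (hX : Consistent n 2 X) : TripleConsistent (TripleMem X) := by
  intro a b c d hab hbc hcd
  by_cases hr : 1 ≤ a ∧ d ≤ n
  · exact (consistent_iff hX.1).1 hX a b c d hr.1 hab hbc hcd hr.2
  · have h1 := TripleMem.bounds hX.1 hab hbc
    have h2 := TripleMem.bounds hX.1 hab (hbc.trans hcd)
    have h3 := TripleMem.bounds hX.1 (hab.trans hbc) hcd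
    have h4 := TripleMem.bounds hX.1 hbc hcd
    unfold Monotone4
    grind

theorem Consistent.union_singleton (hX : Consistent n 2 X) {x y z : ℕ} (hxy : x < y)
    (hyz : y < z) (hmem : {x, y, z} ∈ binom n 3) (hflip : Flippable (TripleMem X) x y z) :
    Consistent n 2 (X ∪ {{x, y, z}}) := by
  have hiff : ∀ a b c, a < b → b < c →
      (TripleMem (X ∪ {{x, y, z}}) a b c ↔ TripleMem X a b c ∨ (a = x ∧ b = y ∧ c = z)) := by
    intro a b c hab hbc
    simp only [TripleMem, Finset.mem_union, Finset.mem_singleton,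
      triple_eq_triple_iff hab hbc hxy hyz]
  refine (consistent_iff (Finset.union_subset hX.1 (Finset.singleton_subset_iff.2 hmem))).2 ?_
  intro a b c d ha hab hbc hcd hd
  rw [hiff a b c hab hbc, hiff a b d hab (hbc.trans hcd), hiff a c d (hab.trans hbc) hcd,
    hiff b c d hbc hcd]
  have hm := hX.tripleConsistent a b c d hab hbc hcd
  obtain ⟨f1, f2, f3, f4⟩ := hflip
  by_cases g1 : a = x ∧ b = y ∧ c = z
  · obtain ⟨rfl, rfl, rfl⟩ := g1
    have := f4 d hcd
    unfold Monotone4 at *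
    grind
  · by_cases g2 : a = x ∧ b = y ∧ d = z
    · obtain ⟨rfl, rfl, rfl⟩ := g2
      have := f3 c hbc hcd
      unfold Monotone4 at *
      grind
    · by_cases g3 : a = x ∧ c = y ∧ d = z
      · obtain ⟨rfl, rfl, rfl⟩ := g3
        have := f2 b hab hbc
        unfold Monotone4 at *
        grind
      · by_cases g4 : b = x ∧ c = y ∧ d = z
        · obtain ⟨rfl, rfl, rfl⟩ := g4
          have := f1 a hab
          unfold Monotone4 at *
          grind
        · simpa only [g1, g2, g3, g4, or_false] using hm

/-- Inclusion of consistent sets is generated by adding single triples. -/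
theorem Consistent.exists_union_singleton (hX : Consistent n 2 X) (hZ : Consistent n 2 Z)
    (hXZ : X ⊂ Z) : ∃ I ∈ Z, I ∉ X ∧ Consistent n 2 (X ∪ {I}) := by
  obtain ⟨I, hIZ, hIX⟩ := Finset.exists_of_ssubset hXZ
  obtain ⟨a, b, c, hab, hbc, rfl⟩ := exists_triple_of_mem_binom (hZ.1 hIZ)
  obtain ⟨x, y, z, hxy, hyz, h1, h0, hflip⟩ :=
    exists_flippable hX.tripleConsistent hZ.tripleConsistent (fun _ _ _ h => hXZ.1 h)
      (fun _ _ _ h => h.le hX.1) ⟨a, b, c, hab, hbc, hIZ, hIX⟩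
  exact ⟨_, h1, h0, hX.union_singleton hxy hyz (hZ.1 h1) hflip⟩

end Bridge

section Moebius

theorem subset_closureHB {n d : ℕ} {S : Finset (Finset ℕ)} (hS : S ⊆ binom n (d + 1)) :
    S ⊆ closureHB n d S := by
  intro I hI
  simp only [closureHB, Finset.mem_filter]
  exact ⟨hS hI, fun T _ hST _ => hST hI⟩

theorem closureHB_subset {n d : ℕ} {S T : Finset (Finset ℕ)} (hT : T ⊆ binom n (d + 1))
    (hTc : IsClosedSet n d T) (hST : S ⊆ T) : closureHB n d S ⊆ T := by
  intro I hI
  simp only [closureHB, Finset.mem_filter] at hI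
  exact hI.2 T hT hST hTc

theorem mem_ascSet {n d : ℕ} {X Y : Finset (Finset ℕ)} {I : Finset ℕ} :
    I ∈ ascSet n d X Y ↔ (I ∈ Y ∧ I ∉ X) ∧ Consistent n d (X ∪ {I}) := by
  simp only [ascSet, Finset.mem_filter, Finset.mem_sdiff]

theorem union_closureHB_subset_iff {n d : ℕ} {X W S : Finset (Finset ℕ)}
    (hW : Consistent n d W) (hXW : X ⊆ W) (hS : S ⊆ binom n (d + 1)) :
    X ∪ closureHB n d S ⊆ W ↔ S ⊆ W :=
  ⟨fun h => (subset_closureHB hS).trans (Finset.subset_union_right.trans h),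
    fun h => Finset.union_subset hXW (closureHB_subset hW.1 hW.2.1 h)⟩

theorem eq_ascSet_of_union_closureHB_eq {n d : ℕ} {X Y S : Finset (Finset ℕ)}
    (hY : Consistent n d Y) (hS : S ⊆ ascSet n d X Y) (hSY : X ∪ closureHB n d S = Y) :
    S = ascSet n d X Y := by
  refine hS.antisymm fun I hI => ?_
  by_contra hIS
  obtain ⟨⟨hIY, hIX⟩, hcons⟩ := mem_ascSet.1 hI
  have hsub : closureHB n d S ⊆ binom n (d + 1) \ (X ∪ {I}) := by
    refine closureHB_subset Finset.sdiff_subset hcons.2.2 fun J hJ => ?_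
    obtain ⟨⟨hJY, hJX⟩, -⟩ := mem_ascSet.1 (hS hJ)
    simp only [Finset.mem_sdiff, Finset.mem_union, Finset.mem_singleton, not_or]
    exact ⟨hY.1 hJY, hJX, fun hJI => hIS (hJI ▸ hJ)⟩
  rw [← hSY, Finset.mem_union] at hIY
  have := hsub (hIY.resolve_left hIX)
  simp at this

theorem mu_eq_of_sum_Icc {α : Type*} [PartialOrder α] [LocallyFiniteOrder α] [DecidableEq α]
    {a : α} (ν : α → ℤ) {b : α}
    (hν : ∀ w, a ≤ w → w ≤ b → ∑ z ∈ Finset.Icc a w, ν z = if a = w then 1 else 0) (hab : a ≤ b) :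
    IncidenceAlgebra.mu ℤ a b = ν b := by
  have key : ∀ k w, a ≤ w → w ≤ b → (Finset.Icc a w).card = k →
      IncidenceAlgebra.mu ℤ a w = ν w := by
    intro k
    induction k using Nat.strong_induction_on with
    | _ k ih =>
      intro w haw hwb hk
      have h1 := IncidenceAlgebra.sum_Icc_mu_right (𝕜 := ℤ) a w
      rw [← hν w haw hwb, ← Finset.Ico_insert_right haw,
        Finset.sum_insert (by simp), Finset.sum_insert (by simp)] at h1
      have h2 : ∑ x ∈ Finset.Ico a w, IncidenceAlgebra.mu ℤ a x = ∑ x ∈ Finset.Ico a w, ν x := by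
        refine Finset.sum_congr rfl fun x hx => ?_
        obtain ⟨hax, hxw⟩ := Finset.mem_Ico.1 hx
        refine ih _ ?_ x hax (hxw.le.trans hwb) rfl
        rw [← hk]
        refine Finset.card_lt_card ((Finset.ssubset_iff_of_subset
          (Finset.Icc_subset_Icc_right hxw.le)).2 ⟨w, by simp [haw], ?_⟩)
        simp [hxw.not_ge]
      rw [h2] at h1
      exact add_right_cancel h1
  exact key _ b hab le_rfl rfl

open Classical in
/-- The signed count of the subsets `S` of `A` with `X ∪ cl(S) = W`. -/
noncomputable def signedCount (n d : ℕ) (X A W : Finset (Finset ℕ)) : ℤ :=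
  ∑ S ∈ A.powerset with X ∪ closureHB n d S = W, (-1) ^ S.card

theorem Facial.sum_Icc_signedCount {n : ℕ} {X Y : Finset (Finset ℕ)} (hfac : Facial n X Y)
    {x w : ConsPoset n} (hx : x.1 = X) (hxw : x ≤ w) (hwY : w.1 ⊆ Y) [Decidable (x = w)] :
    ∑ z ∈ Finset.Icc x w, signedCount n 2 X (ascSet n 2 X Y) z.1 = if x = w then 1 else 0 := by
  classical
  obtain ⟨hX, hY, -, -, hcons⟩ := hfac
  have hXw : X ⊆ w.1 := hx ▸ hxw
  have hA : ascSet n 2 X Y ⊆ binom n 3 := fun I hI => hY.1 (mem_ascSet.1 hI).1.1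
  have h1 : ∑ z ∈ Finset.Icc x w, signedCount n 2 X (ascSet n 2 X Y) z.1 =
      ∑ S ∈ (ascSet n 2 X Y ∩ w.1).powerset, (-1 : ℤ) ^ S.card := by
    simp only [signedCount, Finset.sum_filter]
    rw [Finset.sum_comm, ← Finset.sum_subset (s₁ := (ascSet n 2 X Y ∩ w.1).powerset)
      (Finset.powerset_mono.2 Finset.inter_subset_left)]
    · refine Finset.sum_congr rfl fun S hS => ?_
      obtain ⟨hSA, hSw⟩ := Finset.subset_inter_iff.1 (Finset.mem_powerset.1 hS)
      refine (Finset.sum_eq_single (⟨_, hcons S hSA⟩ : ConsPoset n) ?_ ?_).trans ?_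
      · exact fun z _ hz => if_neg fun h => hz (Subtype.ext h.symm)
      · refine fun h => absurd (Finset.mem_Icc.2 ⟨?_, ?_⟩) h
        · show x.1 ⊆ _
          rw [hx]
          exact Finset.subset_union_left
        · exact (union_closureHB_subset_iff w.2 hXw (hSA.trans hA)).2 hSw
      · exact if_pos rfl
    · intro S hS hSw
      have hSA := Finset.mem_powerset.1 hS
      refine Finset.sum_eq_zero fun z hz => if_neg fun h => hSw ?_
      have hzw : z.1 ⊆ w.1 := (Finset.mem_Icc.1 hz).2
      exact Finset.mem_powerset.2 (Finset.subset_inter hSA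
        ((union_closureHB_subset_iff w.2 hXw (hSA.trans hA)).1 (h ▸ hzw)))
  have h2 : ascSet n 2 X Y ∩ w.1 = ∅ ↔ x = w := by
    constructor
    · intro he
      by_contra hne
      have hss : X ⊂ w.1 := hXw.ssubset_of_ne fun h => hne (Subtype.ext (hx.trans h))
      obtain ⟨I, hIw, hIX, hIc⟩ := hX.exists_union_singleton w.2 hss
      have : I ∈ ascSet n 2 X Y ∩ w.1 :=
        Finset.mem_inter.2 ⟨mem_ascSet.2 ⟨⟨hwY hIw, hIX⟩, hIc⟩, hIw⟩
      simp [he] at this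
    · rintro rfl
      refine Finset.eq_empty_of_forall_notMem fun I hI => ?_
      obtain ⟨hIA, hIx⟩ := Finset.mem_inter.1 hI
      exact (mem_ascSet.1 hIA).1.2 (hx ▸ hIx)
  rw [h1, Finset.sum_powerset_neg_one_pow_card]
  simp only [h2]

theorem Facial.signedCount_eq {n : ℕ} {X Y : Finset (Finset ℕ)} (hfac : Facial n X Y) :
    signedCount n 2 X (ascSet n 2 X Y) Y = (-1) ^ (ascSet n 2 X Y).card := by
  classical
  obtain ⟨-, hY, -, heq, -⟩ := hfac
  rw [signedCount, Finset.sum_filter, Finset.sum_eq_single (ascSet n 2 X Y)]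
  · exact if_pos heq.symm
  · exact fun S hS hne => if_neg fun h =>
      hne (eq_ascSet_of_union_closureHB_eq hY (Finset.mem_powerset.1 hS) h)
  · exact fun h => absurd (Finset.mem_powerset_self _) h

end Moebius

/-- For a facial pair `(X, Y)` the Möbius function of the poset of consistent
subsets of `binom([n],3)` satisfies `μ(X,Y) = (-1)^{|Asc(X,Y)|}`. -/
theorem mu_facial (n : ℕ) (hn : 1 ≤ n) (X Y : Finset (Finset ℕ))
    (hX : Consistent n 2 X) (hY : Consistent n 2 Y) (hXY : X ⊆ Y)
    (hfac : Facial n X Y) :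
    muHB n ⟨X, hX⟩ ⟨Y, hY⟩ = (-1) ^ (ascSet n 2 X Y).card := by
  classical
  rw [← hfac.signedCount_eq]
  exact mu_eq_of_sum_Icc (fun z : ConsPoset n => signedCount n 2 X (ascSet n 2 X Y) z.1)
    (fun w hxw hwy => hfac.sum_Icc_signedCount rfl hxw hwy) hXY
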